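/- Let d = 1, so X ⊆ ℝ is a closed convex set of non-negative reals containing 0. Assume (f_n) is a sequence of monotone non-expansive functions f_n : X → X converging pointwise to a function f : X → X which has at least one fixpoint, and assume each f_n has a least fixpoint μf_n with lim_{n→∞} μf_n = μf. Let ((α_n),(β_n)) be a relaxed Mann-Kleene scheme and x_0 ∈ X. Then the dampened Mann iteration (x_n) with function sequence (f_n) converges to μf. -/

import Mathlib

open Filter Set Topology

/-- The dampened Mann iteration:
`x₀ = x0`, `x_{n+1} = (1 - β n) • (α n • x n + (1 - α n) • f n (x n))`. -/
noncomputable def mannSeq {E : Type*} [AddCommGroup E] [Module ℝ E]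
    (α β : ℕ → ℝ) (f : ℕ → E → E) (x0 : E) : ℕ → E
  | 0 => x0
  | n + 1 => (1 - β n) • (α n • mannSeq α β f x0 n + (1 - α n) • f n (mannSeq α β f x0 n))

/-- A real sequence with `x (n + 1) ≤ (1 - β n) * max (x n) M` eventually stays below `M > 0`
when `β` is not summable. -/
theorem eventually_le_of_le_dampened_max {x β : ℕ → ℝ} {M : ℝ} (hM : 0 < M)
    (hβ : ∀ n, β n ∈ Set.Ico (0 : ℝ) 1) (hβdiv : ¬ Summable β)
    (h : ∀ᶠ n in atTop, x (n + 1) ≤ (1 - β n) * max (x n) M) :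
    ∀ᶠ n in atTop, x n ≤ M := by
  obtain ⟨N, hN⟩ := eventually_atTop.1 h
  have hstay : ∀ m, N ≤ m → x m ≤ M → x (m + 1) ≤ M := by
    intro m hm hx
    have h1 := hN m hm
    rw [max_eq_right hx] at h1
    nlinarith [(hβ m).1]
  by_cases hex : ∃ m, N ≤ m ∧ x m ≤ M
  · obtain ⟨m, hm, hx⟩ := hex
    refine eventually_atTop.2 ⟨m, fun k hk => ?_⟩
    induction k, hk using Nat.le_induction with
    | base => exact hx
    | succ k hk ih => exact hstay k (hm.trans hk) ih
  · push Not at hex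
    refine absurd ((summable_nat_add_iff N).1 ?_) hβdiv
    have hsum : ∀ k, (∑ i ∈ Finset.range k, β (i + N)) * M ≤ x N - x (k + N) := by
      intro k
      induction k with
      | zero => simp
      | succ k ih =>
        have hlt := hex (k + N) (Nat.le_add_left N k)
        have hstep := hN (k + N) (Nat.le_add_left N k)
        rw [max_eq_left hlt.le] at hstep
        rw [Finset.sum_range_succ, add_mul, Nat.add_right_comm]
        nlinarith [(hβ (k + N)).1]
    refine summable_of_sum_range_le (c := x N / M) (fun i => (hβ _).1) fun k => ?_
    rw [le_div_iff₀ hM]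
    linarith [hsum k, hex (k + N) (Nat.le_add_left N k)]

/-- A real sequence with `min (x n) c + η ≤ x (n + 1)` for some `η > 0` eventually stays
above `c`. -/
theorem eventually_ge_of_min_add_le {x : ℕ → ℝ} {c η : ℝ} (hη : 0 < η)
    (h : ∀ᶠ n in atTop, min (x n) c + η ≤ x (n + 1)) :
    ∀ᶠ n in atTop, c ≤ x n := by
  obtain ⟨N, hN⟩ := eventually_atTop.1 h
  have hlow : ∀ k : ℕ, min (x N + k * η) c ≤ x (N + k) := by
    intro k
    induction k with
    | zero => simp
    | succ k ih =>
      have hstep := hN (N + k) (Nat.le_add_right N k)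
      rw [← add_assoc]
      push_cast
      grind
  obtain ⟨K, hK⟩ := exists_nat_gt ((c - x N) / η)
  rw [div_lt_iff₀ hη] at hK
  refine eventually_atTop.2 ⟨N + K, fun n hn => ?_⟩
  obtain ⟨k, rfl⟩ := Nat.exists_eq_add_of_le (le_of_add_le_left hn)
  have hKk : (K : ℝ) ≤ k := by exact_mod_cast Nat.le_of_add_le_add_left hn
  have hmin := hlow k
  rwa [min_eq_right (by nlinarith)] at hmin

/-- The displacement `g x - x` of a non-expansive function is antitone in `x`. -/
theorem LipschitzOnWith.sub_le_sub_of_le {g : ℝ → ℝ} {X : Set ℝ} (hg : LipschitzOnWith 1 g X)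
    {x y : ℝ} (hx : x ∈ X) (hy : y ∈ X) (hxy : x ≤ y) : g y - y ≤ g x - x := by
  have h := hg.dist_le_mul y hy x hx
  rw [NNReal.coe_one, one_mul, Real.dist_eq, Real.dist_eq, abs_of_nonneg (sub_nonneg.2 hxy)] at h
  linarith [le_abs_self (g y - g x)]

/-- The dampened Mann iteration stays in a convex set containing `0`. -/
theorem mannSeq_mem {E : Type*} [AddCommGroup E] [Module ℝ E] {α β : ℕ → ℝ}
    (hα : ∀ n, α n ∈ Set.Ico (0 : ℝ) 1) (hβ : ∀ n, β n ∈ Set.Ico (0 : ℝ) 1)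
    {X : Set E} (hXc : Convex ℝ X) (h0 : (0 : E) ∈ X) {f : ℕ → E → E}
    (hf : ∀ n, Set.MapsTo (f n) X X) {x0 : E} (hx0 : x0 ∈ X) (n : ℕ) :
    mannSeq α β f x0 n ∈ X := by
  induction n with
  | zero => exact hx0
  | succ n ih =>
    refine hXc.smul_mem_of_zero_mem h0 ?_ ⟨sub_nonneg.2 (hβ n).2.le, sub_le_self _ (hβ n).1⟩
    exact hXc ih (hf n ih) (hα n).1 (sub_nonneg.2 (hα n).2.le) (add_sub_cancel _ _)

/-- in dimension one, if the least fixpoints of the monotone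
non-expansive approximations `fn` (converging pointwise to `f`) converge to the
least fixpoint `μf`, then for every relaxed Mann-Kleene scheme the dampened
Mann iteration converges to `μf`. -/
theorem one_dimensional_convergence
    (α β : ℕ → ℝ) (hα : ∀ n, α n ∈ Set.Ico (0 : ℝ) 1) (hβ : ∀ n, β n ∈ Set.Ico (0 : ℝ) 1)
    (hβ0 : Tendsto β atTop (nhds 0)) (hβdiv : ¬ Summable β)
    (a : ℝ) (ha : a < 1) (hαa : Tendsto α atTop (nhds a))
    (X : Set ℝ) (hX : IsClosed X) (hXc : Convex ℝ X)
    (hpos : ∀ x ∈ X, 0 ≤ x) (h0 : (0 : ℝ) ∈ X)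
    (fn : ℕ → ℝ → ℝ)
    (hfnmap : ∀ n, Set.MapsTo (fn n) X X)
    (hfnmono : ∀ n, ∀ x ∈ X, ∀ y ∈ X, x ≤ y → fn n x ≤ fn n y)
    (hfnne : ∀ n, LipschitzOnWith 1 (fn n) X)
    (f : ℝ → ℝ) (hmap : Set.MapsTo f X X)
    (hconv : ∀ x ∈ X, Tendsto (fun n => fn n x) atTop (nhds (f x)))
    (hfix : ∃ x ∈ X, f x = x)
    (μ : ℝ) (hμ : IsLeast {x | x ∈ X ∧ f x = x} μ)
    (μn : ℕ → ℝ) (hμn : ∀ n, IsLeast {x | x ∈ X ∧ fn n x = x} (μn n))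
    (hμconv : Tendsto μn atTop (nhds μ))
    (x0 : ℝ) (hx0 : x0 ∈ X) :
    Tendsto (mannSeq α β fn x0) atTop (nhds μ) := by
  have hmem : ∀ n, mannSeq α β fn x0 n ∈ X := mannSeq_mem hα hβ hXc h0 hfnmap hx0
  have hsucc : ∀ n, mannSeq α β fn x0 (n + 1) = (1 - β n) *
      (α n * mannSeq α β fn x0 n + (1 - α n) * fn n (mannSeq α β fn x0 n)) := fun _ => rfl
  generalize mannSeq α β fn x0 = x at hmem hsucc ⊢
  have hμ0 : 0 ≤ μ := hpos μ hμ.1.1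
  refine tendsto_order.2 ⟨fun l hl => ?_, fun u hu => ?_⟩
  · rcases lt_or_ge l 0 with hl0 | hl0
    · exact Eventually.of_forall fun n => hl0.trans_le (hpos _ (hmem n))
    obtain ⟨c, hlc, hcμ⟩ := exists_between hl
    have hc0 : 0 ≤ c := hl0.trans hlc.le
    have hcX : c ∈ X := hXc.ordConnected.out h0 hμ.1.1 ⟨hc0, hcμ.le⟩
    have hcf : c < f c := by
      refine lt_of_le_of_ne (ge_of_tendsto (hconv c hcX) ?_)
        fun h => hcμ.not_ge (hμ.2 ⟨hcX, h.symm⟩)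
      filter_upwards [hμconv.eventually_const_lt hcμ] with n hn
      have := (hfnne n).sub_le_sub_of_le hcX (hμn n).1.1 hn.le
      linarith [(hμn n).1.2]
    obtain ⟨d, hcd, hdf⟩ := exists_between hcf
    obtain ⟨b, hab, hb⟩ := exists_between ha
    have hη : 0 < (1 - b) * (d - c) := mul_pos (sub_pos.2 hb) (sub_pos.2 hcd)
    set η := (1 - b) * (d - c) with hη_def
    have hβη : ∀ᶠ n in atTop, β n < η / 2 / (c + η) :=
      hβ0.eventually_lt_const (by positivity)
    have hlow : ∀ᶠ n in atTop, c ≤ x n := by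
      refine eventually_ge_of_min_add_le (half_pos hη) ?_
      filter_upwards [hβη, hαa.eventually_lt_const hab, (hconv c hcX).eventually_const_lt hdf]
        with n hβn hαn hfc
      rw [lt_div_iff₀ (by positivity)] at hβn
      have hα0 := (hα n).1
      have hβ0 := (hβ n).1
      have hmin : min (x n) c + (d - c) ≤ fn n (x n) := by
        rcases le_total (x n) c with hxc | hxc
        · rw [min_eq_left hxc]
          linarith [(hfnne n).sub_le_sub_of_le (hmem n) hcX hxc]
        · rw [min_eq_right hxc]
          linarith [hfnmono n c hcX _ (hmem n) hxc]
      have hstep : min (x n) c + η ≤ α n * x n + (1 - α n) * fn n (x n) := by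
        have h1 : α n * min (x n) c ≤ α n * x n :=
          mul_le_mul_of_nonneg_left (min_le_left _ _) hα0
        have h2 : (1 - α n) * (min (x n) c + (d - c)) ≤ (1 - α n) * fn n (x n) :=
          mul_le_mul_of_nonneg_left hmin (sub_nonneg.2 (hα n).2.le)
        have h3 : η ≤ (1 - α n) * (d - c) :=
          mul_le_mul_of_nonneg_right (by linarith) (sub_nonneg.2 hcd.le)
        linarith
      rw [hsucc]
      have h1 := mul_le_mul_of_nonneg_left hstep (sub_nonneg.2 (hβ n).2.le)
      have h2 : β n * (min (x n) c + η) ≤ β n * (c + η) :=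
        mul_le_mul_of_nonneg_left (by linarith [min_le_right (x n) c]) hβ0
      linarith
    exact hlow.mono fun n hn => hlc.trans_le hn
  · obtain ⟨M, hμM, hMu⟩ := exists_between hu
    have hup : ∀ᶠ n in atTop, x n ≤ M := by
      refine eventually_le_of_le_dampened_max (hμ0.trans_lt hμM) hβ hβdiv ?_
      filter_upwards [hμconv.eventually_lt_const hμM] with n hn
      have hf : fn n (x n) ≤ max (x n) M := by
        rcases le_total (x n) (μn n) with hxμ | hxμ
        · refine (hfnmono n _ (hmem n) _ (hμn n).1.1 hxμ).trans ?_
          rw [(hμn n).1.2]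
          exact hn.le.trans (le_max_right _ _)
        · refine le_trans ?_ (le_max_left _ _)
          linarith [(hfnne n).sub_le_sub_of_le (hμn n).1.1 (hmem n) hxμ, (hμn n).1.2]
      rw [hsucc]
      refine mul_le_mul_of_nonneg_left ?_ (sub_nonneg.2 (hβ n).2.le)
      have h1 := mul_le_mul_of_nonneg_left (le_max_left (x n) M) (hα n).1
      have h2 := mul_le_mul_of_nonneg_left hf (sub_nonneg.2 (hα n).2.le)
      linarith
    exact hup.mono fun n hn => hn.trans_lt hMu
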